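/- Let Ω ⊂ ℝ^N be a bounded open set, μ the Lebesgue measure restricted to Ω, T > 0, and let u ∈ H¹(0,T;L²(μ)) with time derivative v. Let φ : ℝ → ℝ be a non-decreasing, bounded, Lipschitz-continuous function with φ(0) = 0, and set ψ(s) = ∫₀ˢ φ(σ) dσ. Then for every smooth compactly supported function ϕ ∈ C_c^∞(Ω) and all 0 ≤ s ≤ t ≤ T one has ∫_Ω ϕ(x) ψ(u(t)(x)) dx − ∫_Ω ϕ(x) ψ(u(s)(x)) dx = ∫_s^t ( ∫_Ω ϕ(x) φ(u(σ)(x)) · v(σ)(x) dx ) dσ. -/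

import Mathlib

open MeasureTheory intervalIntegral

open Set Filter Topology in
/-- A function whose increments are dominated by those of an absolutely continuous function is
absolutely continuous. -/
theorem AbsolutelyContinuousOnInterval.of_dist_le {X Y : Type*} [PseudoMetricSpace X]
    [PseudoMetricSpace Y] {f : ℝ → X} {g : ℝ → Y} {a b K : ℝ}
    (hg : AbsolutelyContinuousOnInterval g a b)
    (hfg : ∀ x ∈ uIcc a b, ∀ y ∈ uIcc a b, dist (f x) (f y) ≤ K * dist (g x) (g y)) :
    AbsolutelyContinuousOnInterval f a b := by
  have hlim := Tendsto.const_mul K hg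
  rw [mul_zero] at hlim
  refine squeeze_zero' (Eventually.of_forall fun E => Finset.sum_nonneg fun i _ => dist_nonneg)
    ?_ hlim
  filter_upwards [mem_inf_of_right (mem_principal_self _)] with E hE
  rw [Finset.mul_sum]
  exact Finset.sum_le_sum fun i hi => hfg _ (hE.1 i hi).1 _ (hE.1 i hi).2

open Set in
/-- Chain rule for a Lipschitz differentiable functional along a Bochner primitive. -/
theorem IntervalIntegrable.integral_fderiv_apply_primitive {E : Type*} [NormedAddCommGroup E]
    [NormedSpace ℝ E] [CompleteSpace E] {F : E → ℝ} {F' : E → E →L[ℝ] ℝ} {K : NNReal}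
    (hF : ∀ x, HasFDerivAt F (F' x) x) (hK : LipschitzWith K F) {v : ℝ → E} {a b : ℝ}
    (hv : IntervalIntegrable v volume a b) (x₀ : E) :
    ∫ σ in a..b, F' (x₀ + ∫ τ in a..σ, v τ) (v σ) = F (x₀ + ∫ τ in a..b, v τ) - F x₀ := by
  set w : ℝ → E := fun t => x₀ + ∫ τ in a..t, v τ with hw
  have hsub : ∀ x ∈ uIcc a b, ∀ y ∈ uIcc a b, IntervalIntegrable v volume x y :=
    fun x hx y hy => hv.mono_set (uIcc_subset_uIcc hx hy)
  have hac : AbsolutelyContinuousOnInterval (F ∘ w) a b := by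
    refine (hv.norm.absolutelyContinuousOnInterval_intervalIntegral
      (c := a) left_mem_uIcc).of_dist_le (K := K) fun x hx y hy => ?_
    refine (hK.dist_le_mul _ _).trans (mul_le_mul_of_nonneg_left ?_ K.2)
    have hax := hsub a left_mem_uIcc x hx
    have hay := hsub a left_mem_uIcc y hy
    rw [dist_eq_norm, dist_eq_norm, hw, add_sub_add_left_eq_sub,
      integral_interval_sub_left hax hay, integral_interval_sub_left hax.norm hay.norm,
      Real.norm_eq_abs]
    exact norm_integral_le_abs_integral_norm
  have hderiv : ∀ᵐ σ, σ ∈ uIoc a b → deriv (F ∘ w) σ = F' (w σ) (v σ) := by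
    filter_upwards [hv.ae_hasDerivAt_integral] with σ hσ hmem
    exact ((hF (w σ)).comp_hasDerivAt σ
      ((hσ (uIoc_subset_uIcc hmem) a left_mem_uIcc).const_add x₀)).deriv
  rw [← integral_congr_ae hderiv, hac.integral_deriv_eq_sub]
  simp [hw]

/-- First-order Taylor estimate for the primitive of a Lipschitz function. -/
theorem LipschitzWith.abs_integral_sub_sub_mul_le {φ : ℝ → ℝ} {L : NNReal}
    (hφ : LipschitzWith L φ) (a b : ℝ) :
    |(∫ σ in (0:ℝ)..b, φ σ) - (∫ σ in (0:ℝ)..a, φ σ) - φ a * (b - a)| ≤ L * (b - a) ^ 2 := by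
  have hi := fun x y => hφ.continuous.intervalIntegrable (μ := volume) x y
  have hconst : φ a * (b - a) = ∫ _ in a..b, φ a := by simp [mul_comm]
  rw [integral_interval_sub_left (hi _ _) (hi _ _), hconst,
    ← intervalIntegral.integral_sub (hi _ _) (by simp), ← Real.norm_eq_abs]
  refine (intervalIntegral.norm_integral_le_of_norm_le_const (C := L * |b - a|) fun x hx => ?_).trans ?_
  · have hx' : |x - a| ≤ |b - a| := Set.abs_sub_left_of_mem_uIcc (Set.uIoc_subset_uIcc hx)
    have h := hφ.dist_le_mul x a
    rw [dist_eq_norm, Real.dist_eq] at h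
    exact h.trans (mul_le_mul_of_nonneg_left hx' L.2)
  · rw [mul_assoc, ← sq, sq_abs]

section Superposition

variable {α : Type*} [MeasurableSpace α] {μ : Measure α} [IsFiniteMeasure μ]
  {φ : ℝ → ℝ} {θ : α → ℝ} {L : NNReal} {C M : ℝ}

theorem memLp_mul_comp (hφ : LipschitzWith L φ) (hM : ∀ s, |φ s| ≤ M)
    (hθ : AEStronglyMeasurable θ μ) (hC : ∀ x, |θ x| ≤ C) (w : Lp ℝ 2 μ) :
    MemLp (fun x => θ x * φ (w x)) 2 μ := by
  refine MemLp.of_bound (hθ.mul (hφ.continuous.comp_aestronglyMeasurable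
    (Lp.aestronglyMeasurable w))) (C * M) (Filter.Eventually.of_forall fun x => ?_)
  rw [norm_mul]
  exact mul_le_mul (hC x) (hM _) (norm_nonneg _) ((abs_nonneg _).trans (hC x))

theorem integrable_mul_primitive_comp (hφ : LipschitzWith L φ) (hM : ∀ s, |φ s| ≤ M)
    (hθ : AEStronglyMeasurable θ μ) (hC : ∀ x, |θ x| ≤ C) (w : Lp ℝ 2 μ) :
    Integrable (fun x => θ x * ∫ σ in (0:ℝ)..w x, φ σ) μ := by
  have hcont : Continuous fun s => ∫ σ in (0:ℝ)..s, φ σ :=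
    continuous_primitive (fun x y => hφ.continuous.intervalIntegrable x y) 0
  have hw : Integrable w μ := (Lp.memLp w).integrable one_le_two
  refine Integrable.bdd_mul (c := C) ?_ hθ (Filter.Eventually.of_forall hC)
  refine (hw.norm.const_mul M).mono'
    (hcont.comp_aestronglyMeasurable (Lp.aestronglyMeasurable w))
    (Filter.Eventually.of_forall fun x => ?_)
  simpa using intervalIntegral.norm_integral_le_of_norm_le_const (f := φ) (C := M)
    (a := 0) (b := w x) fun s _ => hM s

/-- The derivative of `w ↦ ∫ θ ψ(w) dμ` on `L²(μ)`, where `ψ` is a primitive of `φ`. -/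
noncomputable def weightedPrimitiveFDeriv (hφ : LipschitzWith L φ) (hM : ∀ s, |φ s| ≤ M)
    (hθ : AEStronglyMeasurable θ μ) (hC : ∀ x, |θ x| ≤ C) (w : Lp ℝ 2 μ) : Lp ℝ 2 μ →L[ℝ] ℝ :=
  innerSL ℝ (memLp_mul_comp hφ hM hθ hC w).toLp

theorem weightedPrimitiveFDeriv_apply (hφ : LipschitzWith L φ) (hM : ∀ s, |φ s| ≤ M)
    (hθ : AEStronglyMeasurable θ μ) (hC : ∀ x, |θ x| ≤ C) (w h : Lp ℝ 2 μ) :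
    weightedPrimitiveFDeriv hφ hM hθ hC w h = ∫ x, θ x * (φ (w x) * h x) ∂μ := by
  rw [weightedPrimitiveFDeriv, innerSL_apply_apply, L2.inner_def]
  refine integral_congr_ae ?_
  filter_upwards [(memLp_mul_comp hφ hM hθ hC w).coeFn_toLp] with x hx
  rw [hx, RCLike.inner_apply, conj_trivial]
  ring

theorem norm_weightedPrimitiveFDeriv_le (hφ : LipschitzWith L φ) (hM : ∀ s, |φ s| ≤ M)
    (hθ : AEStronglyMeasurable θ μ) (hC : ∀ x, |θ x| ≤ C) (hC0 : 0 ≤ C) (w : Lp ℝ 2 μ) :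
    ‖weightedPrimitiveFDeriv hφ hM hθ hC w‖ ≤
      measureUnivNNReal μ ^ (2 : ENNReal).toReal⁻¹ * (C * M) := by
  rw [weightedPrimitiveFDeriv, innerSL_apply_norm]
  refine Lp.norm_le_of_ae_bound (mul_nonneg hC0 ((abs_nonneg _).trans (hM 0))) ?_
  filter_upwards [(memLp_mul_comp hφ hM hθ hC w).coeFn_toLp] with x hx
  rw [hx, norm_mul]
  exact mul_le_mul (hC x) (hM _) (norm_nonneg _) hC0

theorem hasFDerivAt_integral_mul_primitive_comp (hφ : LipschitzWith L φ) (hM : ∀ s, |φ s| ≤ M)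
    (hθ : AEStronglyMeasurable θ μ) (hC : ∀ x, |θ x| ≤ C) (hC0 : 0 ≤ C) (w : Lp ℝ 2 μ) :
    HasFDerivAt (fun w : Lp ℝ 2 μ => ∫ x, θ x * (∫ σ in (0:ℝ)..w x, φ σ) ∂μ)
      (weightedPrimitiveFDeriv hφ hM hθ hC w) w := by
  refine .of_isLittleO (Asymptotics.IsBigO.trans_isLittleO (g := fun z => ‖z - w‖ ^ 2) ?_
    (Asymptotics.isLittleO_pow_sub_sub w one_lt_two))
  refine Asymptotics.IsBigO.of_bound (C * L) (Filter.Eventually.of_forall fun z => ?_)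
  have hsq : Integrable (fun x => (z - w : Lp ℝ 2 μ) x ^ 2) μ := (Lp.memLp (z - w)).integrable_sq
  have hnorm : ‖z - w‖ ^ 2 = ∫ x, (z - w : Lp ℝ 2 μ) x ^ 2 ∂μ := by
    rw [← real_inner_self_eq_norm_sq, L2.inner_def]
    simp [sq]
  have hi := integrable_mul_primitive_comp hφ hM hθ hC
  have hlin : Integrable (fun x => θ x * (φ (w x) * (z - w : Lp ℝ 2 μ) x)) μ := by
    simpa only [Pi.mul_def, mul_assoc] using
      (memLp_mul_comp hφ hM hθ hC w).integrable_mul (Lp.memLp (z - w))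
  have hdiff := (hi z).sub (hi w)
  simp only [Pi.sub_def] at hdiff
  rw [weightedPrimitiveFDeriv_apply, ← integral_sub (hi z) (hi w), ← integral_sub hdiff hlin,
    norm_pow, norm_norm, hnorm, ← MeasureTheory.integral_const_mul]
  refine MeasureTheory.norm_integral_le_of_norm_le (hsq.const_mul _) ?_
  filter_upwards [Lp.coeFn_sub z w] with x hx
  rw [hx, Pi.sub_apply, ← mul_sub, ← mul_sub, norm_mul, mul_assoc]
  exact mul_le_mul (hC x) (hφ.abs_integral_sub_sub_mul_le _ _) (norm_nonneg _) hC0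

end Superposition

/-- Localized chain rule for the time derivative. Let `Ω ⊂ ℝ^N` be a
bounded open set, `μ` the Lebesgue measure restricted to `Ω`, `T > 0`, and
`u ∈ H¹(0,T;L²(μ))` with time derivative `v`. Let `φ : ℝ → ℝ` be non-decreasing,
bounded, Lipschitz with `φ(0) = 0`, and `ψ(s) = ∫₀ˢ φ(σ) dσ`. Then for every
`ϕ ∈ C_c^∞(Ω)` and all `0 ≤ s ≤ t ≤ T`,
`∫ ϕ ψ(u(t)) dμ − ∫ ϕ ψ(u(s)) dμ = ∫ₛᵗ (∫ ϕ φ(u(σ)) v(σ) dμ) dσ`. -/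
theorem stmt1 (N : ℕ) (hN : 2 ≤ N)
    (Ω : Set (EuclideanSpace ℝ (Fin N))) (hΩo : IsOpen Ω) (hΩb : Bornology.IsBounded Ω)
    (μ : Measure (EuclideanSpace ℝ (Fin N))) (hμ : μ = volume.restrict Ω)
    (T : ℝ) (hT : 0 < T)
    (u v : ℝ → Lp ℝ 2 μ)
    (hv_meas : StronglyMeasurable v)
    (hv_int : IntegrableOn (fun s => ‖v s‖ ^ 2) (Set.Icc 0 T))
    (hu : ∀ t ∈ Set.Icc (0:ℝ) T, u t = u 0 + ∫ s in (0:ℝ)..t, v s)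
    (φ ψ : ℝ → ℝ)
    (hφ_mono : Monotone φ) (hφ_bdd : ∃ M : ℝ, ∀ s : ℝ, |φ s| ≤ M)
    (hφ_lip : ∃ L : NNReal, LipschitzWith L φ) (hφ0 : φ 0 = 0)
    (hψ : ∀ s : ℝ, ψ s = ∫ σ in (0:ℝ)..s, φ σ)
    (ϕ : EuclideanSpace ℝ (Fin N) → ℝ)
    (hϕ_smooth : ContDiff ℝ (⊤ : ℕ∞) ϕ) (hϕ_supp : HasCompactSupport ϕ)
    (hϕ_in : tsupport ϕ ⊆ Ω) :
    ∀ s t : ℝ, 0 ≤ s → s ≤ t → t ≤ T →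
      (∫ x, ϕ x * ψ (u t x) ∂μ) - (∫ x, ϕ x * ψ (u s x) ∂μ) =
        ∫ σ in s..t, ∫ x, ϕ x * (φ (u σ x) * v σ x) ∂μ := by
  intro s t hs hst htT
  have hfin : IsFiniteMeasure μ := by
    rw [hμ]
    exact ⟨by simpa using hΩb.measure_lt_top⟩
  obtain ⟨M, hM⟩ := hφ_bdd
  obtain ⟨L, hL⟩ := hφ_lip
  obtain ⟨C, hC⟩ := hϕ_supp.exists_bound_of_continuous hϕ_smooth.continuous
  have hC0 : 0 ≤ C := (norm_nonneg _).trans (hC 0)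
  have hθ : AEStronglyMeasurable ϕ μ := hϕ_smooth.continuous.aestronglyMeasurable
  have hvT : IntervalIntegrable v volume 0 T := by
    rw [intervalIntegrable_iff_integrableOn_Icc_of_le hT.le]
    exact ((memLp_two_iff_integrable_sq_norm hv_meas.aestronglyMeasurable).2 hv_int).integrable
      one_le_two
  have hv {x y : ℝ} (hx : x ∈ Set.Icc 0 T) (hy : y ∈ Set.Icc 0 T) :
      IntervalIntegrable v volume x y :=
    hvT.mono_set (by rw [Set.uIcc_of_le hT.le]; exact Set.ordConnected_Icc.uIcc_subset hx hy)
  have h0mem : (0:ℝ) ∈ Set.Icc 0 T := ⟨le_rfl, hT.le⟩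
  have hsmem : s ∈ Set.Icc 0 T := ⟨hs, hst.trans htT⟩
  have hus {σ : ℝ} (hσ : σ ∈ Set.Icc s t) : u σ = u s + ∫ τ in s..σ, v τ := by
    have hσ' : σ ∈ Set.Icc 0 T := ⟨hs.trans hσ.1, hσ.2.trans htT⟩
    rw [hu σ hσ', hu s hsmem, add_assoc,
      integral_add_adjacent_intervals (hv h0mem hsmem) (hv hsmem hσ')]
  have hlip := lipschitzWith_of_nnnorm_fderiv_le
    (fun w => (hasFDerivAt_integral_mul_primitive_comp hL hM hθ hC hC0 w).differentiableAt)
    (C := (measureUnivNNReal μ ^ (2 : ENNReal).toReal⁻¹ * (C * M)).toNNReal) fun w => by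
      rw [(hasFDerivAt_integral_mul_primitive_comp hL hM hθ hC hC0 w).fderiv]
      exact NNReal.le_toNNReal_of_coe_le (norm_weightedPrimitiveFDeriv_le hL hM hθ hC hC0 w)
  have key := (hv hsmem ⟨hs.trans hst, htT⟩).integral_fderiv_apply_primitive
    (hasFDerivAt_integral_mul_primitive_comp hL hM hθ hC hC0) hlip (u s)
  rw [← hus ⟨hst, le_rfl⟩] at key
  simp only [hψ]
  rw [← key]
  refine integral_congr fun σ hσ => ?_
  rw [Set.uIcc_of_le hst] at hσ
  simp only [weightedPrimitiveFDeriv_apply, ← hus hσ]
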